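/- arXiv:2210.07989 — 2 statements merged into one kernel-verified Lean document; each statement's English description precedes it below -/
import Mathlib

section
/- Let φ and ψ be lsc submeasures such that I = Exh(φ) and J = Exh(ψ) are translation invariant ideals, with I containing an infinite subset of ℕ. Let a be a uniform base sequence adapted to both I and J. Let H_I = { r ∈ ℝ : j_a(|r|) ∈ I } and H_J = { r ∈ ℝ : j_a(|r|) ∈ J }, with ρ_I(r,s) = φ(j_a(|r−s|)) + |r−s| on H_I and ρ_J(r,s) = ψ(j_a(|r−s|)) + |r−s| on H_J. If f : H_I → H_J is additive, satisfies f(q·r) = q·f(r) for all q ∈ ℚ_a and r ∈ H_I, and is ρ-continuous (for every r ∈ H_I and ε > 0 there is δ > 0 such that for all s ∈ H_I, ρ_I(r,s) < δ implies ρ_J(f(r), f(s)) < ε), then there exists c ∈ ℝ such that f(y) = c·y for all y ∈ H_I. -/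
open Set Filter
open scoped ENNReal

/-- `a₀ a₁ ⋯ a_{n-1}` as a real number: the product of the first `n` terms of the
base sequence (the paper's `a₁ ⋯ a_n`, re-indexed from 0). -/
noncomputable def bProd (a : ℕ → ℕ) (n : ℕ) : ℝ := ∏ k ∈ Finset.range n, (a k : ℝ)

/-- The `n`-th digit (0-indexed; the paper's `(n+1)`-st digit) of the nonnegative
real `r` in base `a`:  `r_n = ⌊a₁⋯a_n (r - ⌊r⌋)⌋ - a_n ⌊a₁⋯a_{n-1} (r - ⌊r⌋)⌋`. -/
noncomputable def digit (a : ℕ → ℕ) (r : ℝ) (n : ℕ) : ℤ :=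
  ⌊bProd a (n + 1) * Int.fract r⌋ - (a n : ℤ) * ⌊bProd a n * Int.fract r⌋

/-- `j_a(r) = { n : r_n ≠ r_{n+1} }`. -/
def jSet (a : ℕ → ℕ) (r : ℝ) : Set ℕ := {n | digit a r n ≠ digit a r (n + 1)}

/-- An ideal of subsets of ℕ: closed under subsets and finite unions, containing
all singletons (hence nonempty). -/
def IsIdeal (I : Set (Set ℕ)) : Prop :=
  (∀ ⦃x y : Set ℕ⦄, x ∈ I → y ⊆ x → y ∈ I) ∧
  (∀ ⦃x y : Set ℕ⦄, x ∈ I → y ∈ I → x ∪ y ∈ I) ∧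
  (∀ n : ℕ, ({n} : Set ℕ) ∈ I)

/-- Translation invariance of a family of subsets of ℕ. -/
def TransInv (I : Set (Set ℕ)) : Prop :=
  ∀ x ∈ I, ({n | ∃ m ∈ x, n = m + 1} ∈ I) ∧ ({n | n + 1 ∈ x} ∈ I)

/-- A tall family: every infinite set of naturals has an infinite subset in the family. -/
def TallIdeal (I : Set (Set ℕ)) : Prop :=
  ∀ x : Set ℕ, x.Infinite → ∃ y, y ⊆ x ∧ y.Infinite ∧ y ∈ I

/-- The base sequence `a` is adapted to `I` if `{n : a_n ≠ a_{n+1}} ∈ I`. -/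
def AdaptedTo (a : ℕ → ℕ) (I : Set (Set ℕ)) : Prop := {n | a n ≠ a (n + 1)} ∈ I

/-- A lower semicontinuous submeasure on subsets of ℕ. -/
def IsLscSubmeasure (φ : Set ℕ → ℝ≥0∞) : Prop :=
  φ ∅ = 0 ∧
  (∀ ⦃x y : Set ℕ⦄, x ⊆ y → φ x ≤ φ y) ∧
  (∀ x y : Set ℕ, φ (x ∪ y) ≤ φ x + φ y) ∧
  (∀ n : ℕ, 0 < φ {n} ∧ φ {n} < ⊤) ∧
  (∀ x : Set ℕ, φ x = ⨆ n : ℕ, φ (x ∩ {k | k < n}))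

/-- `Exh(φ) = { x ⊆ ℕ : φ(x \ {0,…,n-1}) → 0 }`. -/
def Exh (φ : Set ℕ → ℝ≥0∞) : Set (Set ℕ) :=
  {x | Filter.Tendsto (fun n => φ (x \ {k | k < n})) Filter.atTop (nhds 0)}

/-- `pr(a)`: the set of primes dividing `a_n` for all but finitely many `n`. -/
def prSet (a : ℕ → ℕ) : Set ℕ := {p | p.Prime ∧ ∀ᶠ n in Filter.atTop, p ∣ a n}

/-- A base sequence is uniform if every prime dividing some `a_n` divides `a_n`
for all but finitely many `n`. -/
def UniformBase (a : ℕ → ℕ) : Prop :=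
  ∀ p : ℕ, p.Prime → (∃ n, p ∣ a n) → ∀ᶠ n in Filter.atTop, p ∣ a n

/-- `ℚ_a`, viewed as a set of real numbers: fractions `k/l` with every prime
divisor of `l` in `pr(a)`. -/
def Qa (a : ℕ → ℕ) : Set ℝ :=
  {r | ∃ (k : ℤ) (l : ℕ), 0 < l ∧ (∀ p : ℕ, p.Prime → p ∣ l → p ∈ prSet a) ∧
    r = (k : ℝ) / (l : ℝ)}

/-- `H = { r ∈ ℝ : j_a(|r|) ∈ I }`. -/
def Hset (a : ℕ → ℕ) (I : Set (Set ℕ)) : Set ℝ := {r | jSet a |r| ∈ I}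

/-- `ρ(r,s) = φ(j_a(|r-s|)) + |r-s|`. -/
noncomputable def rho (a : ℕ → ℕ) (φ : Set ℕ → ℝ≥0∞) (r s : ℝ) : ℝ :=
  (φ (jSet a |r - s|)).toReal + |r - s|

theorem bProd_succ (a : ℕ → ℕ) (n : ℕ) : bProd a (n + 1) = bProd a n * a n :=
  Finset.prod_range_succ _ _

theorem bProd_pos {a : ℕ → ℕ} (ha : ∀ n, 2 ≤ a n) (n : ℕ) : 0 < bProd a n :=
  Finset.prod_pos fun k _ => by have := ha k; positivity

theorem two_pow_le_bProd {a : ℕ → ℕ} (ha : ∀ n, 2 ≤ a n) (n : ℕ) : 2 ^ n ≤ bProd a n := by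
  induction n with
  | zero => simp [bProd]
  | succ n ih =>
    rw [bProd_succ, pow_succ]
    have : (2 : ℝ) ≤ a n := by exact_mod_cast ha n
    exact mul_le_mul ih this zero_le_two (bProd_pos ha n).le

theorem bProd_monotone {a : ℕ → ℕ} (ha : ∀ n, 2 ≤ a n) : Monotone (bProd a) := by
  refine monotone_nat_of_le_succ fun n => ?_
  rw [bProd_succ]
  have : (2 : ℝ) ≤ a n := by exact_mod_cast ha n
  exact le_mul_of_one_le_right (bProd_pos ha n).le (by linarith)

theorem exists_bProd_eq_mul (a : ℕ → ℕ) {N m : ℕ} (h : N ≤ m) :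
    ∃ c : ℤ, bProd a m = c * bProd a N := by
  induction m, h using Nat.le_induction with
  | base => exact ⟨1, by simp⟩
  | succ m _ ih =>
    obtain ⟨c, hc⟩ := ih
    exact ⟨c * a m, by rw [bProd_succ, hc]; push_cast; ring⟩

/-- Shifting the fractional part by a multiple of `1 / (a₀ ⋯ a_{N-1})` does not change the
digits from position `N` on. -/
theorem digit_eq_of_fract_eq_add {a : ℕ → ℕ} (ha : ∀ n, 2 ≤ a n) {r s : ℝ} {k : ℤ} {N m : ℕ}
    (h : Int.fract r = Int.fract s + k / bProd a N) (hm : N ≤ m) :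
    digit a r m = digit a s m := by
  obtain ⟨c, hc⟩ := exists_bProd_eq_mul a hm
  have hN := (bProd_pos ha N).ne'
  have h1 : bProd a m * Int.fract r = bProd a m * Int.fract s + (c * k : ℤ) := by
    rw [h, hc]; push_cast; field_simp
  have h2 : bProd a (m + 1) * Int.fract r
      = bProd a (m + 1) * Int.fract s + (a m * (c * k) : ℤ) := by
    rw [h, bProd_succ, hc]; push_cast; field_simp
  rw [digit, digit, h1, h2, Int.floor_add_intCast, Int.floor_add_intCast]
  ring

theorem digit_eq_zero {a : ℕ → ℕ} (ha : ∀ n, 2 ≤ a n) {r : ℝ} {N m : ℕ}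
    (h : bProd a N * Int.fract r < 1) (hm : m < N) : digit a r m = 0 := by
  have key : ∀ i ≤ N, ⌊bProd a i * Int.fract r⌋ = 0 := fun i hi => by
    rw [Int.floor_eq_zero_iff]
    exact ⟨mul_nonneg (bProd_pos ha i).le (Int.fract_nonneg r),
      (mul_le_mul_of_nonneg_right (bProd_monotone ha hi) (Int.fract_nonneg r)).trans_lt h⟩
  simp [digit, key m hm.le, key (m + 1) hm]

theorem digit_zero_right (a : ℕ → ℕ) (m : ℕ) : digit a 0 m = 0 := by simp [digit]

/-- The truncation of `y` to its first `N` digits. -/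
noncomputable def trunc (a : ℕ → ℕ) (y : ℝ) (N : ℕ) : ℝ :=
  ⌊y⌋ + ⌊bProd a N * Int.fract y⌋ / bProd a N

theorem sub_trunc_nonneg {a : ℕ → ℕ} (ha : ∀ n, 2 ≤ a n) (y : ℝ) (N : ℕ) :
    0 ≤ y - trunc a y N := by
  have hN := bProd_pos ha N
  have : (⌊bProd a N * Int.fract y⌋ : ℝ) / bProd a N ≤ Int.fract y := by
    rw [div_le_iff₀' hN]; exact Int.floor_le _
  have := Int.self_sub_floor y
  rw [trunc]; linarith

theorem bProd_mul_sub_trunc_lt {a : ℕ → ℕ} (ha : ∀ n, 2 ≤ a n) (y : ℝ) (N : ℕ) :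
    bProd a N * (y - trunc a y N) < 1 := by
  have hN := bProd_pos ha N
  have h : bProd a N * (y - trunc a y N)
      = bProd a N * Int.fract y - ⌊bProd a N * Int.fract y⌋ := by
    rw [trunc, ← Int.self_sub_floor y]; field_simp; ring
  rw [h, Int.self_sub_floor]
  exact Int.fract_lt_one _

theorem sub_trunc_lt {a : ℕ → ℕ} (ha : ∀ n, 2 ≤ a n) (y : ℝ) (N : ℕ) :
    y - trunc a y N < (1 / 2) ^ N := by
  have h1 := bProd_mul_sub_trunc_lt ha y N
  have h2 := mul_le_mul_of_nonneg_right (two_pow_le_bProd ha N) (sub_trunc_nonneg ha y N)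
  rw [one_div, inv_pow, ← one_div, lt_div_iff₀' (by positivity)]
  linarith

theorem fract_sub_trunc {a : ℕ → ℕ} (ha : ∀ n, 2 ≤ a n) (y : ℝ) (N : ℕ) :
    Int.fract (y - trunc a y N) = y - trunc a y N :=
  Int.fract_eq_self.2 ⟨sub_trunc_nonneg ha y N,
    (sub_trunc_lt ha y N).trans_le (pow_le_one₀ (by norm_num) (by norm_num))⟩

theorem trunc_nonneg {a : ℕ → ℕ} (ha : ∀ n, 2 ≤ a n) {y : ℝ} (hy : 0 ≤ y) (N : ℕ) :
    0 ≤ trunc a y N := by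
  have h1 : (0 : ℝ) ≤ ⌊y⌋ := by exact_mod_cast Int.floor_nonneg.2 hy
  have hN := bProd_pos ha N
  have h2 : (0 : ℝ) ≤ ⌊bProd a N * Int.fract y⌋ := by
    exact_mod_cast Int.floor_nonneg.2 (mul_nonneg hN.le (Int.fract_nonneg y))
  rw [trunc]; positivity

theorem fract_trunc {a : ℕ → ℕ} (ha : ∀ n, 2 ≤ a n) (y : ℝ) (N : ℕ) :
    Int.fract (trunc a y N) = ⌊bProd a N * Int.fract y⌋ / bProd a N := by
  have hN := bProd_pos ha N
  have h2 : (0 : ℝ) ≤ ⌊bProd a N * Int.fract y⌋ := by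
    exact_mod_cast Int.floor_nonneg.2 (mul_nonneg hN.le (Int.fract_nonneg y))
  rw [trunc, Int.fract_intCast_add, Int.fract_eq_self]
  refine ⟨by positivity, ?_⟩
  rw [div_lt_one hN]
  exact (Int.floor_le _).trans_lt (mul_lt_of_lt_one_right hN (Int.fract_lt_one y))

theorem trunc_mem_Qa {a : ℕ → ℕ} (ha : ∀ n, 2 ≤ a n) (hu : UniformBase a) (y : ℝ) (N : ℕ) :
    trunc a y N ∈ Qa a := by
  have hN := bProd_pos ha N
  have hcast : ((∏ k ∈ Finset.range N, a k : ℕ) : ℝ) = bProd a N := by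
    push_cast; rfl
  refine ⟨⌊y⌋ * (∏ k ∈ Finset.range N, a k : ℕ) + ⌊bProd a N * Int.fract y⌋,
    ∏ k ∈ Finset.range N, a k, ?_, fun p hp hdvd => ⟨hp, ?_⟩, ?_⟩
  · exact Finset.prod_pos fun k _ => by have := ha k; lia
  · obtain ⟨k, -, hk⟩ := (hp.prime.dvd_finsetProd_iff _).1 hdvd
    exact hu p hp ⟨k, hk⟩
  · rw [Int.cast_add, Int.cast_mul, Int.cast_natCast, hcast, trunc]
    field_simp

theorem jSet_sub_trunc_subset {a : ℕ → ℕ} (ha : ∀ n, 2 ≤ a n) (y : ℝ) (n : ℕ) :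
    jSet a (y - trunc a y (n + 1)) ⊆ {n} ∪ jSet a y \ {k | k < n} := by
  intro m hm
  have hlow : ∀ i < n + 1, digit a (y - trunc a y (n + 1)) i = 0 := fun i hi =>
    digit_eq_zero ha (by rw [fract_sub_trunc ha]; exact bProd_mul_sub_trunc_lt ha y _) hi
  have hhigh : ∀ i, n + 1 ≤ i → digit a y i = digit a (y - trunc a y (n + 1)) i := fun i hi =>
    digit_eq_of_fract_eq_add (k := ⌊bProd a (n + 1) * Int.fract y⌋) ha (by
      rw [fract_sub_trunc ha, trunc, ← Int.self_sub_floor y]; ring) hi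
  rcases lt_trichotomy m n with h | h | h
  · exact absurd (by rw [hlow m (by lia), hlow (m + 1) (by lia)]) hm
  · exact Or.inl h
  · refine Or.inr ⟨?_, h.not_gt⟩
    change digit a y m ≠ digit a y (m + 1)
    rw [hhigh m h, hhigh (m + 1) (by lia)]
    exact hm

theorem jSet_trunc_subset {a : ℕ → ℕ} (ha : ∀ n, 2 ≤ a n) (y : ℝ) (N : ℕ) :
    jSet a (trunc a y N) ⊆ {k | k < N} := by
  intro m hm
  by_contra h
  have key : ∀ i, N ≤ i → digit a (trunc a y N) i = 0 := fun i hi =>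
    (digit_eq_of_fract_eq_add ha (by rw [fract_trunc ha, Int.fract_zero, zero_add]) hi).trans
      (digit_zero_right a i)
  have h' : N ≤ m := not_lt.1 h
  exact hm (by rw [key m h', key (m + 1) (by lia)])

theorem mem_Exh_of_subset_lt {φ : Set ℕ → ℝ≥0∞} (h0 : φ ∅ = 0) {x : Set ℕ} {N : ℕ}
    (hx : x ⊆ {k | k < N}) : x ∈ Exh φ := by
  refine tendsto_const_nhds.congr' ?_
  filter_upwards [eventually_ge_atTop N] with n hn
  have hempty : x \ {k | k < n} = ∅ :=
    Set.sdiff_eq_empty.2 fun k hk => (hx hk : k < N).trans_le hn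
  rw [hempty, h0]

theorem trunc_mem_Hset {a : ℕ → ℕ} (ha : ∀ n, 2 ≤ a n) {φ : Set ℕ → ℝ≥0∞} (h0 : φ ∅ = 0)
    {y : ℝ} (hy : 0 ≤ y) (N : ℕ) : trunc a y N ∈ Hset a (Exh φ) := by
  change jSet a |trunc a y N| ∈ Exh φ
  rw [abs_of_nonneg (trunc_nonneg ha hy N)]
  exact mem_Exh_of_subset_lt h0 (jSet_trunc_subset ha y N)

theorem one_mem_Hset (a : ℕ → ℕ) {φ : Set ℕ → ℝ≥0∞} (h0 : φ ∅ = 0) :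
    (1 : ℝ) ∈ Hset a (Exh φ) :=
  mem_Exh_of_subset_lt (N := 0) h0 fun m hm => (hm (by simp [digit])).elim

/-- Since `Exh φ` contains an infinite set, truncations of `y` are `ρ`-dense near `y`. -/
theorem exists_rho_trunc_lt {a : ℕ → ℕ} (ha : ∀ n, 2 ≤ a n) {φ : Set ℕ → ℝ≥0∞}
    (hφ : IsLscSubmeasure φ) (hinf : ∃ x ∈ Exh φ, x.Infinite) {y : ℝ}
    (hy : jSet a y ∈ Exh φ) {δ : ℝ} (hδ : 0 < δ) :
    ∃ N, rho a φ y (trunc a y N) < δ ∧ |y - trunc a y N| < δ := by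
  obtain ⟨-, hmono, hunion, -, -⟩ := hφ
  obtain ⟨x, hx, hxinf⟩ := hinf
  have hsum : Tendsto (fun n => φ (x \ {k | k < n}) + φ (jSet a y \ {k | k < n}))
      atTop (nhds 0) := by
    simpa using Tendsto.add hx hy
  have hpow : Tendsto (fun n : ℕ => (1 / 2 : ℝ) ^ (n + 1)) atTop (nhds 0) :=
    (tendsto_pow_atTop_nhds_zero_of_lt_one (by norm_num) (by norm_num)).comp
      (tendsto_add_atTop_nat 1)
  have hev := (hsum.eventually (gt_mem_nhds (ENNReal.ofReal_pos.2 (half_pos hδ)))).and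
    (hpow.eventually (gt_mem_nhds (half_pos hδ)))
  obtain ⟨n, hnx, hn1, hn2⟩ :=
    ((Nat.frequently_atTop_iff_infinite.2 hxinf).and_eventually hev).exists
  have habs : |y - trunc a y (n + 1)| < δ / 2 := by
    rw [abs_of_nonneg (sub_trunc_nonneg ha y _)]
    exact (sub_trunc_lt ha y _).trans hn2
  have hsub : φ (jSet a |y - trunc a y (n + 1)|) < ENNReal.ofReal (δ / 2) := by
    rw [abs_of_nonneg (sub_trunc_nonneg ha y _)]
    refine lt_of_le_of_lt ?_ hn1
    calc φ (jSet a (y - trunc a y (n + 1))) ≤ φ ({n} ∪ jSet a y \ {k | k < n}) :=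
          hmono (jSet_sub_trunc_subset ha y n)
      _ ≤ φ {n} + φ (jSet a y \ {k | k < n}) := hunion _ _
      _ ≤ _ := by
          gcongr
          refine hmono ?_
          rintro m (rfl : m = n)
          exact ⟨hnx, lt_irrefl m⟩
  have htoReal : (φ (jSet a |y - trunc a y (n + 1)|)).toReal < δ / 2 :=
    (ENNReal.lt_ofReal_iff_toReal_lt hsub.ne_top).1 hsub
  exact ⟨n + 1, by rw [rho]; linarith, by linarith⟩

/-- Lemma 3.4: every ρ-continuous `ℚ_a`-module homomorphism
`H_I → H_J` is multiplication by a real constant. -/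
theorem hom_eq_smul (a : ℕ → ℕ) (ha : ∀ n, 2 ≤ a n) (hu : UniformBase a)
    (φ ψ : Set ℕ → ℝ≥0∞) (hφ : IsLscSubmeasure φ) (hψ : IsLscSubmeasure ψ)
    (hidI : IsIdeal (Exh φ)) (hidJ : IsIdeal (Exh ψ))
    (htrI : TransInv (Exh φ)) (htrJ : TransInv (Exh ψ))
    (hadI : AdaptedTo a (Exh φ)) (hadJ : AdaptedTo a (Exh ψ))
    (hinf : ∃ x ∈ Exh φ, x.Infinite)
    (f : ℝ → ℝ)
    (hmaps : Set.MapsTo f (Hset a (Exh φ)) (Hset a (Exh ψ)))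
    (hadd : ∀ r ∈ Hset a (Exh φ), ∀ s ∈ Hset a (Exh φ), f (r + s) = f r + f s)
    (hsmul : ∀ q ∈ Qa a, ∀ r ∈ Hset a (Exh φ), f (q * r) = q * f r)
    (hcont : ∀ r ∈ Hset a (Exh φ), ∀ ε : ℝ, 0 < ε → ∃ δ : ℝ, 0 < δ ∧
      ∀ s ∈ Hset a (Exh φ), rho a φ r s < δ → rho a ψ (f r) (f s) < ε) :
    ∃ c : ℝ, ∀ y ∈ Hset a (Exh φ), f y = c * y := by
  have h0 : φ ∅ = 0 := hφ.1
  have hnonneg : ∀ y ∈ Hset a (Exh φ), 0 ≤ y → f y = f 1 * y := by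
    intro y hy hy0
    have hj : jSet a y ∈ Exh φ := by
      have : jSet a |y| ∈ Exh φ := hy
      rwa [abs_of_nonneg hy0] at this
    refine eq_of_forall_dist_le fun ε hε => ?_
    obtain ⟨δ, hδ, hδ'⟩ := hcont y hy (ε / 2) (half_pos hε)
    have hc : 0 < |f 1| + 1 := by positivity
    obtain ⟨N, hρ, hN⟩ := exists_rho_trunc_lt ha hφ hinf hj
      (lt_min hδ (div_pos (half_pos hε) hc))
    have hclose := hδ' _ (trunc_mem_Hset ha h0 hy0 N) (hρ.trans_le (min_le_left _ _))
    have hval : f (trunc a y N) = trunc a y N * f 1 := by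
      simpa using hsmul _ (trunc_mem_Qa ha hu y N) 1 (one_mem_Hset a h0)
    have h1 : |f y - trunc a y N * f 1| < ε / 2 := by
      rw [← hval]
      exact lt_of_le_of_lt (le_add_of_nonneg_left ENNReal.toReal_nonneg) hclose
    have h2 : |trunc a y N * f 1 - f 1 * y| ≤ ε / 2 := by
      have hlt := hN.trans_le (min_le_right _ _)
      rw [lt_div_iff₀ hc] at hlt
      rw [show trunc a y N * f 1 - f 1 * y = -((y - trunc a y N) * f 1) by ring, abs_neg,
        abs_mul]
      nlinarith [abs_nonneg (y - trunc a y N)]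
    rw [Real.dist_eq]
    linarith [abs_sub_le (f y) (trunc a y N * f 1) (f 1 * y)]
  refine ⟨f 1, fun y hy => ?_⟩
  rcases le_total 0 y with hy0 | hy0
  · exact hnonneg y hy hy0
  · have hneg : f (-1 * y) = -1 * f y := by
      refine hsmul _ ⟨-1, 1, one_pos, fun p hp hdvd => ?_, by norm_num⟩ y hy
      exact absurd (Nat.dvd_one.1 hdvd) hp.ne_one
    have hy' : -y ∈ Hset a (Exh φ) := by
      change jSet a |-y| ∈ Exh φ
      rwa [abs_neg]
    have := hnonneg (-y) hy' (by linarith)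
    rw [neg_one_mul] at hneg
    linarith
end

section
/- Let φ be an lsc submeasure. Then: (ii) for each ε > 0 there exists δ > 0 such that for all x, y ⊆ ℕ, if φ(x) < δ and φ(y) < δ then φ(x ∪ y) < ε; and (iii) if the ideal Exh(φ) is translation invariant, then for each ε > 0 there exists δ > 0 such that for every x ⊆ ℕ with φ(x) < δ, both φ({ n : n+1 ∈ x }) < ε and φ({ n+1 : n ∈ x }) < ε. -/
open Set Filter
open scoped ENNReal

namespace IsLscSubmeasure

variable {φ : Set ℕ → ℝ≥0∞}

lemma mono (hφ : IsLscSubmeasure φ) : Monotone φ := fun _ _ h => hφ.2.1 h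

lemma biUnion_range_le (hφ : IsLscSubmeasure φ) (x : ℕ → Set ℕ) (m : ℕ) :
    φ (⋃ k ∈ Finset.range m, x k) ≤ ∑ k ∈ Finset.range m, φ (x k) := by
  induction m with
  | zero => simp [hφ.1]
  | succ m ih =>
    rw [Finset.sum_range_succ, Finset.range_add_one, Finset.set_biUnion_insert, union_comm]
    exact (hφ.2.2.1 _ _).trans (by gcongr)

/-- Countable subadditivity along a sequence of sets that leaves every initial segment. -/
lemma iUnion_le_tsum (hφ : IsLscSubmeasure φ) {x : ℕ → Set ℕ} (hx : ∀ k, ∀ i ∈ x k, k ≤ i) :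
    φ (⋃ k, x k) ≤ ∑' k, φ (x k) := by
  rw [hφ.2.2.2.2]
  refine iSup_le fun n => ?_
  refine (hφ.mono ?_).trans ((hφ.biUnion_range_le x n).trans (ENNReal.sum_le_tsum _))
  rintro i ⟨hi, hin⟩
  obtain ⟨k, hk⟩ := mem_iUnion.1 hi
  exact mem_biUnion (Finset.mem_coe.2 (Finset.mem_range.2 ((hx k i hk).trans_lt hin))) hk

lemma exists_pos_le_singleton (hφ : IsLscSubmeasure φ) (n : ℕ) :
    ∃ δ : ℝ≥0∞, 0 < δ ∧ ∀ x, φ x < δ → ∀ i ∈ x, n < i := by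
  refine ⟨(Finset.range (n + 1)).inf fun i => φ {i},
    (Finset.lt_inf_iff ENNReal.zero_lt_top).2 fun i _ => (hφ.2.2.2.1 i).1, fun x hx i hi => ?_⟩
  by_contra! hin
  refine hx.not_ge ((Finset.inf_le (Finset.mem_range.2 (Nat.lt_succ_of_le hin))).trans ?_)
  exact hφ.mono (singleton_subset_iff.2 hi)

lemma iUnion_mem_exh (hφ : IsLscSubmeasure φ) {x : ℕ → Set ℕ} (hx : ∀ k, ∀ i ∈ x k, k ≤ i)
    (hfin : ∀ k, (x k).Finite) (hsum : ∑' k, φ (x k) ≠ ⊤) : (⋃ k, x k) ∈ Exh φ := by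
  refine ENNReal.tendsto_nhds_zero.2 fun η hη => ?_
  obtain ⟨K, hK⟩ :=
    (ENNReal.tendsto_nhds_zero.1 (ENNReal.tendsto_sum_nat_add _ hsum) η hη).exists
  obtain ⟨N, hN⟩ := ((Finset.range K).finite_toSet.biUnion fun k _ => hfin k).bddAbove
  filter_upwards [eventually_gt_atTop N] with n hn
  refine le_trans (hφ.mono ?_) ((hφ.iUnion_le_tsum (x := fun k => x (k + K))
    fun k i hi => (Nat.le_add_right k K).trans (hx _ i hi)).trans hK)
  rintro i ⟨hi, hin⟩
  obtain ⟨k, hk⟩ := mem_iUnion.1 hi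
  have hKk : K ≤ k := by
    by_contra! hkK
    exact hin (lt_of_le_of_lt (hN (mem_biUnion (by simpa using hkK) hk)) hn)
  exact mem_iUnion.2 ⟨k - K, by simpa [Nat.sub_add_cancel hKk] using hk⟩

/-- A monotone operation on sets that moves points by at most one and preserves `Exh φ`
is continuous at `∅` with respect to `φ`. -/
lemma exists_pos_forall_lt (hφ : IsLscSubmeasure φ) {S : Set ℕ → Set ℕ} (hS : Monotone S)
    (hSinter : ∀ x n, S x ∩ {k | k < n} ⊆ S (x ∩ {k | k < n + 1}))
    (hSge : ∀ x n, (∀ i ∈ x, n < i) → ∀ i ∈ S x, n ≤ i)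
    (hSexh : ∀ x ∈ Exh φ, S x ∈ Exh φ) {ε : ℝ≥0∞} (hε : 0 < ε) :
    ∃ δ : ℝ≥0∞, 0 < δ ∧ ∀ x, φ x < δ → φ (S x) < ε := by
  by_contra! H
  obtain ⟨η, hη, hηε⟩ := exists_between hε
  obtain ⟨w, hw, hwsum⟩ := ENNReal.exists_pos_sum_of_countable one_ne_zero ℕ
  have hex : ∀ k : ℕ, ∃ x : Set ℕ,
      x.Finite ∧ φ x ≤ w k ∧ (∀ i ∈ x, k < i) ∧ η < φ (S x) := by
    intro k
    obtain ⟨δ, hδ, hδx⟩ := hφ.exists_pos_le_singleton k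
    obtain ⟨x, hx, hxS⟩ := H (min (w k) δ) (lt_min (by exact_mod_cast hw k) hδ)
    rw [hφ.2.2.2.2] at hxS
    obtain ⟨n, hn⟩ := lt_iSup_iff.1 (hηε.trans_le hxS)
    exact ⟨x ∩ {k | k < n + 1}, (finite_lt_nat (n + 1)).inter_of_right x,
      (hφ.mono inter_subset_left).trans (hx.le.trans (min_le_left _ _)),
      fun i hi => hδx x (hx.trans_le (min_le_right _ _)) i hi.1,
      hn.trans_le (hφ.mono (hSinter x n))⟩
  choose x hfin hxw hxk hxS using hex
  have hmem : (⋃ k, x k) ∈ Exh φ := hφ.iUnion_mem_exh (fun k i hi => (hxk k i hi).le) hfin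
    ((ENNReal.tsum_le_tsum hxw).trans_lt (hwsum.trans ENNReal.one_lt_top)).ne
  obtain ⟨n, hn⟩ := (ENNReal.tendsto_nhds_zero.1 (hSexh _ hmem) η hη).exists
  refine (hxS n).not_ge (le_trans (hφ.mono ?_) hn)
  exact fun i hi => ⟨hS (subset_iUnion x n) hi, not_lt.2 (hSge _ n (hxk n) i hi)⟩

end IsLscSubmeasure

/-- Lemma 2.7(ii),(iii). -/
theorem submeasure_union_and_shift (φ : Set ℕ → ℝ≥0∞) (hφ : IsLscSubmeasure φ) :
    (∀ ε : ℝ≥0∞, 0 < ε → ∃ δ : ℝ≥0∞, 0 < δ ∧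
      ∀ x y : Set ℕ, φ x < δ → φ y < δ → φ (x ∪ y) < ε) ∧
    (TransInv (Exh φ) →
      ∀ ε : ℝ≥0∞, 0 < ε → ∃ δ : ℝ≥0∞, 0 < δ ∧
        ∀ x : Set ℕ, φ x < δ →
          φ {n | n + 1 ∈ x} < ε ∧ φ {n | ∃ m ∈ x, n = m + 1} < ε) := by
  refine ⟨fun ε hε => ⟨ε / 2, ENNReal.half_pos hε.ne', fun x y hx hy => ?_⟩, fun hT ε hε => ?_⟩
  · calc φ (x ∪ y) ≤ φ x + φ y := hφ.2.2.1 x y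
      _ < ε / 2 + ε / 2 := ENNReal.add_lt_add hx hy
      _ = ε := ENNReal.add_halves ε
  · obtain ⟨δ, hδ, hl⟩ := hφ.exists_pos_forall_lt (S := fun x => {n | n + 1 ∈ x})
      (fun x y h n hn => h hn) (fun x n i hi => ⟨hi.1, Nat.succ_lt_succ hi.2⟩)
      (fun x n h i hi => Nat.le_of_lt_succ (h _ hi)) (fun x hx => (hT x hx).2) hε
    obtain ⟨δ', hδ', hr⟩ := hφ.exists_pos_forall_lt (S := fun x => {n | ∃ m ∈ x, n = m + 1})
      (fun x y h n ⟨m, hm, e⟩ => ⟨m, h hm, e⟩)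
      (by rintro x n _ ⟨⟨m, hm, rfl⟩, hi : m + 1 < n⟩
          exact ⟨m, ⟨hm, show m < n + 1 by lia⟩, rfl⟩)
      (by rintro x n h _ ⟨m, hm, rfl⟩
          exact (h m hm).le.trans m.le_succ)
      (fun x hx => (hT x hx).1) hε
    exact ⟨min δ δ', lt_min hδ hδ', fun x hx =>
      ⟨hl x (hx.trans_le (min_le_left _ _)), hr x (hx.trans_le (min_le_right _ _))⟩⟩
end
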